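/- If a and b are even natural numbers, c is an odd natural number, and a > c, then Player 1 has a winning strategy in the (a,b,c)-game; that is, the state with a ones, b twos, and c threes is a first-player win in the reversed Zeckendorf game. -/

import Mathlib

/-- The Fibonacci numbers indexed so that `zfib 1 = 1`, `zfib 2 = 2`,
and `zfib (i+1) = zfib i + zfib (i-1)`. -/
def zfib (i : ℕ) : ℕ := Nat.fib (i + 1)

/-- A game state: a finitely supported function recording the height of each bin.
Bin indices start at `1`; index `0` is unused. -/
abbrev ZState := ℕ →₀ ℕ

/-- The legal moves of the reversed Zeckendorf game. -/
inductive ZMove : ZState → ZState → Prop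
  | split (h : ZState) (i : ℕ) (hi : 2 ≤ i) (hpos : 0 < h (i + 1)) :
      ZMove h (h - Finsupp.single (i + 1) 1 + Finsupp.single i 1 + Finsupp.single (i - 1) 1)
  | splitTwo (h : ZState) (hpos : 0 < h 2) :
      ZMove h (h - Finsupp.single 2 1 + Finsupp.single 1 2)
  | combine (h : ZState) (i : ℕ) (hi : 2 < i) (h1 : 0 < h (i + 1)) (h2 : 0 < h (i - 2)) :
      ZMove h (h - Finsupp.single (i + 1) 1 - Finsupp.single (i - 2) 1 + Finsupp.single i 2)
  | combineTwo (h : ZState) (h1 : 0 < h 3) (h2 : 0 < h 1) :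
      ZMove h (h - Finsupp.single 3 1 - Finsupp.single 1 1 + Finsupp.single 2 2)

mutual
  /-- The state is a first-player win: some legal move leads to a state that is a
  loss for the player then to move. -/
  inductive ZFirstWin : ZState → Prop
    | intro (h h' : ZState) (m : ZMove h h') (hl : ZLoss h') : ZFirstWin h
  /-- The state is a loss for the player to move (i.e., not a first-player win):
  every legal move leads to a first-player win for the opponent. -/
  inductive ZLoss : ZState → Prop
    | intro (h : ZState) (hall : ∀ h', ZMove h h' → ZFirstWin h') : ZLoss h
end

/-- The starting state of the `(a,b,c)`-game: `a` ones, `b` twos and `c` threes. -/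
noncomputable def abcState (a b c : ℕ) : ZState :=
  Finsupp.single 1 a + Finsupp.single 2 b + Finsupp.single 3 c

theorem abc_one (a b c : ℕ) : abcState a b c 1 = a := by
  simp [abcState, Finsupp.single_apply]

theorem abc_two (a b c : ℕ) : abcState a b c 2 = b := by
  simp [abcState, Finsupp.single_apply]

theorem abc_three (a b c : ℕ) : abcState a b c 3 = c := by
  simp [abcState, Finsupp.single_apply]

theorem abc_big (a b c i : ℕ) (hi : 4 ≤ i) : abcState a b c i = 0 := by
  have h1 : (1 : ℕ) ≠ i := by omega
  have h2 : (2 : ℕ) ≠ i := by omega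
  have h3 : (3 : ℕ) ≠ i := by omega
  simp [abcState, Finsupp.single_apply, h1, h2, h3]

theorem abc_split (a b c : ℕ) (hc : 0 < c) :
    abcState a b c - Finsupp.single (2 + 1) 1 + Finsupp.single 2 1 + Finsupp.single (2 - 1) 1
      = abcState (a + 1) (b + 1) (c - 1) := by
  ext j
  simp only [abcState, Finsupp.add_apply, Finsupp.tsub_apply, Finsupp.single_apply]
  split_ifs <;> omega

theorem abc_splitTwo (a b c : ℕ) (hb : 0 < b) :
    abcState a b c - Finsupp.single 2 1 + Finsupp.single 1 2
      = abcState (a + 2) (b - 1) c := by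
  ext j
  simp only [abcState, Finsupp.add_apply, Finsupp.tsub_apply, Finsupp.single_apply]
  split_ifs <;> omega

theorem abc_combine (a b c : ℕ) (ha : 0 < a) (hc : 0 < c) :
    abcState a b c - Finsupp.single 3 1 - Finsupp.single 1 1 + Finsupp.single 2 2
      = abcState (a - 1) (b + 2) (c - 1) := by
  ext j
  simp only [abcState, Finsupp.add_apply, Finsupp.tsub_apply, Finsupp.single_apply]
  split_ifs <;> omega

/-- The losing positions among the states supported on the first three bins. -/
def LPos (a b c : ℕ) : Prop :=
  b % 2 = 0 ∧ ((a % 2 = 0 ∧ a ≤ c) ∨ (c % 2 = 0 ∧ c ≤ a))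

theorem abc_main (n : ℕ) : ∀ a b c : ℕ, 3 * c + b = n →
    (LPos a b c → ZLoss (abcState a b c)) ∧ (¬ LPos a b c → ZFirstWin (abcState a b c)) := by
  induction n using Nat.strong_induction_on with
  | _ n ih =>
    intro a b c hn
    constructor
    · intro hL
      refine ZLoss.intro _ ?_
      intro h' m
      generalize hs : abcState a b c = s at m
      cases m with
      | split i hi hpos =>
        subst hs
        by_cases h2 : i = 2
        · subst h2
          have hc : 0 < c := by simpa [abc_three] using hpos
          rw [abc_split a b c hc]
          refine (ih (3 * (c - 1) + (b + 1)) (by omega) _ _ _ rfl).2 ?_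
          unfold LPos at *; omega
        · rw [abc_big a b c (i + 1) (by omega)] at hpos
          omega
      | splitTwo hpos =>
        subst hs
        rw [abc_two] at hpos
        rw [abc_splitTwo a b c hpos]
        refine (ih (3 * c + (b - 1)) (by omega) _ _ _ rfl).2 ?_
        unfold LPos at *; omega
      | combine i hi h1 h2 =>
        subst hs
        rw [abc_big a b c (i + 1) (by omega)] at h1
        omega
      | combineTwo h1 h2 =>
        subst hs
        rw [abc_three] at h1
        rw [abc_one] at h2
        rw [abc_combine a b c h2 h1]
        refine (ih (3 * (c - 1) + (b + 2)) (by omega) _ _ _ rfl).2 ?_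
        unfold LPos at *; omega
    · intro hL
      have key : (0 < c ∧ LPos (a + 1) (b + 1) (c - 1)) ∨ (0 < b ∧ LPos (a + 2) (b - 1) c) ∨
          (0 < a ∧ 0 < c ∧ LPos (a - 1) (b + 2) (c - 1)) := by
        unfold LPos at *; omega
      rcases key with ⟨hc, h⟩ | ⟨hb, h⟩ | ⟨ha, hc, h⟩
      · have m := ZMove.split (abcState a b c) 2 le_rfl (by simpa [abc_three] using hc)
        rw [abc_split a b c hc] at m
        exact ZFirstWin.intro _ _ m ((ih (3 * (c - 1) + (b + 1)) (by omega) _ _ _ rfl).1 h)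
      · have m := ZMove.splitTwo (abcState a b c) (by simpa [abc_two] using hb)
        rw [abc_splitTwo a b c hb] at m
        exact ZFirstWin.intro _ _ m ((ih (3 * c + (b - 1)) (by omega) _ _ _ rfl).1 h)
      · have m := ZMove.combineTwo (abcState a b c) (by simpa [abc_three] using hc)
          (by simpa [abc_one] using ha)
        rw [abc_combine a b c ha hc] at m
        exact ZFirstWin.intro _ _ m ((ih (3 * (c - 1) + (b + 2)) (by omega) _ _ _ rfl).1 h)

theorem abcGame_even_even_odd_gt_firstPlayerWin (a b c : ℕ) (ha : Even a) (hb : Even b) (hc : Odd c) (hac : a > c) :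
    ZFirstWin (abcState a b c) := by
  refine (abc_main _ a b c rfl).2 ?_
  rw [Nat.odd_iff] at hc
  unfold LPos
  omega
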